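/- arXiv:1101.1680 — 4 statements merged into one kernel-verified Lean document; each statement's English description precedes it below -/
import Mathlib

section
/- (Quasi-regularity of AReadk; Lemma 1, part 1.) In the duplicate-write/k-scan model, suppose k ≥ 1, the writer performs N ≤ k − 1 AWrite operations, and the values x₀, x₁, …, x_N are pairwise distinct. If an AReadk returns a unanimous value v, then v = x_i for some index i with L ≤ i ≤ N, where L is the largest index i such that e_i^b is less than the start time of the AReadk's first low-level read (L = 0 if no AWrite completes before the AReadk begins). In particular, v is never a contaminated (arbitrary) value, and v is never older than the value of the last AWrite completed before the AReadk begins. -/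
open scoped Classical

/-- A writer execution in the duplicate-write model: safe registers `R_a` and
`R_b` initially both hold `x 0`; the writer performs `N` AWrite operations
with values `x 1, …, x N`, the `i`-th AWrite being a low-level write of `x i`
to `R_a` over the real interval `[sa i, ea i]` followed by a low-level write
of `x i` to `R_b` over `[sb i, eb i]`, with all write intervals sequential. -/
structure DWWriter (N : ℕ) where
  x : ℕ → ℕ
  sa : ℕ → ℝ
  ea : ℕ → ℝ
  sb : ℕ → ℝ
  eb : ℕ → ℝ
  ha : ∀ i, 1 ≤ i → i ≤ N → sa i ≤ ea i
  hb : ∀ i, 1 ≤ i → i ≤ N → sb i ≤ eb i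
  hab : ∀ i, 1 ≤ i → i ≤ N → ea i < sb i
  hba : ∀ i, 1 ≤ i → i < N → eb i < sa (i + 1)

/-- Index of the last write to `R_a` completed before time `t`
(`0` if no write to `R_a` completes before `t`). -/
noncomputable def lastA {N : ℕ} (W : DWWriter N) (t : ℝ) : ℕ :=
  ((Finset.range (N + 1)).filter (fun i => 1 ≤ i ∧ W.ea i < t)).sup id

/-- Index of the last write to `R_b` completed before time `t`; since the
`i`-th AWrite completes when its write to `R_b` does, this is the index of the
last AWrite completed before time `t` (`0` if there is none). -/
noncomputable def lastB {N : ℕ} (W : DWWriter N) (t : ℝ) : ℕ :=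
  ((Finset.range (N + 1)).filter (fun i => 1 ≤ i ∧ W.eb i < t)).sup id

/-- A `k`-scan read sequence (AReadk): `2k` low-level reads over sequential
real intervals, alternating a read of `R_a` over `[ras j, rae j]` returning
`alpha j` with a read of `R_b` over `[rbs j, rbe j]` returning `beta j`,
for `j = 1, …, k`. -/
structure KScan (k : ℕ) where
  ras : ℕ → ℝ
  rae : ℕ → ℝ
  rbs : ℕ → ℝ
  rbe : ℕ → ℝ
  alpha : ℕ → ℕ
  beta : ℕ → ℕ
  hra : ∀ j, 1 ≤ j → j ≤ k → ras j ≤ rae j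
  hrb : ∀ j, 1 ≤ j → j ≤ k → rbs j ≤ rbe j
  hab : ∀ j, 1 ≤ j → j ≤ k → rae j < rbs j
  hba : ∀ j, 1 ≤ j → j < k → rbe j < ras (j + 1)

/-- Safe-register semantics: any low-level read whose interval is disjoint
from every write interval on the same register returns the value written by
the last write to that register completed before the read starts (the initial
value `x 0` if no such write exists).  Reads overlapping a write on the same
register are unconstrained (they may return an arbitrary value). -/
def SafeSem {N k : ℕ} (W : DWWriter N) (R : KScan k) : Prop :=
  (∀ j, 1 ≤ j → j ≤ k →
      (∀ i, 1 ≤ i → i ≤ N → R.rae j < W.sa i ∨ W.ea i < R.ras j) →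
      R.alpha j = W.x (lastA W (R.ras j))) ∧
  (∀ j, 1 ≤ j → j ≤ k →
      (∀ i, 1 ≤ i → i ≤ N → R.rbe j < W.sb i ∨ W.eb i < R.rbs j) →
      R.beta j = W.x (lastB W (R.rbs j)))

/-- The AReadk returns the unanimous value `v`: all `2k` low-level reads
return `v`. -/
def Returns {k : ℕ} (R : KScan k) (v : ℕ) : Prop :=
  ∀ j, 1 ≤ j → j ≤ k → R.alpha j = v ∧ R.beta j = v

theorem lastA_le {N : ℕ} (W : DWWriter N) (t : ℝ) : lastA W t ≤ N := by
  refine Finset.sup_le fun i hi => ?_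
  simp only [Finset.mem_filter, Finset.mem_range] at hi
  exact Nat.lt_succ_iff.mp hi.1

theorem lastB_le {N : ℕ} (W : DWWriter N) (t : ℝ) : lastB W t ≤ N := by
  refine Finset.sup_le fun i hi => ?_
  simp only [Finset.mem_filter, Finset.mem_range] at hi
  exact Nat.lt_succ_iff.mp hi.1

theorem lastB_mono {N : ℕ} (W : DWWriter N) : Monotone (lastB W) := by
  refine fun s t hst => Finset.sup_mono fun i hi => ?_
  simp only [Finset.mem_filter] at hi ⊢
  exact ⟨hi.1, hi.2.1, hi.2.2.trans_le hst⟩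

theorem lastB_le_lastA {N : ℕ} (W : DWWriter N) (t : ℝ) : lastB W t ≤ lastA W t := by
  refine Finset.sup_mono fun i hi => ?_
  simp only [Finset.mem_filter, Finset.mem_range] at hi ⊢
  obtain ⟨hi, h1, ht⟩ := hi
  have hiN : i ≤ N := Nat.lt_succ_iff.mp hi
  exact ⟨hi, h1, ((W.hab i h1 hiN).trans_le (W.hb i h1 hiN)).trans ht⟩

/-- Each write to `R_b` ends before any later write to `R_a` starts. -/
theorem DWWriter.eb_lt_sa {N : ℕ} (W : DWWriter N) {m i : ℕ} (hm : 1 ≤ m) (hmi : m < i)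
    (hi : i ≤ N) : W.eb m < W.sa i := by
  induction i, hmi using Nat.le_induction with
  | base => exact W.hba m hm hi
  | succ i hmi ih =>
    have h1 : 1 ≤ i := by omega
    have hiN : i ≤ N := by omega
    linarith [ih hiN, W.ha i h1 hiN, W.hab i h1 hiN, W.hb i h1 hiN, W.hba i h1 hi]

/-- Each write to `R_a` ends before the write to `R_b` of the same or a later AWrite starts. -/
theorem DWWriter.ea_lt_sb {N : ℕ} (W : DWWriter N) {i m : ℕ} (hi : 1 ≤ i) (him : i ≤ m)
    (hm : m ≤ N) : W.ea i < W.sb m := by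
  rcases him.eq_or_lt with rfl | him
  · exact W.hab i hi hm
  · have hiN : i ≤ N := him.le.trans hm
    have h1 : 1 ≤ m := hi.trans him.le
    linarith [W.hab i hi hiN, W.hb i hi hiN, W.eb_lt_sa hi him hm, W.ha m h1 hm, W.hab m h1 hm]

theorem KScan.ras_one_le {k : ℕ} (R : KScan k) {j : ℕ} (hj : 1 ≤ j) (hjk : j ≤ k) :
    R.ras 1 ≤ R.ras j := by
  induction j, hj using Nat.le_induction with
  | base => exact le_rfl
  | succ j hj ih =>
    have hjk' : j ≤ k := by omega
    linarith [ih hjk', R.hra j hj hjk', R.hab j hj hjk', R.hrb j hj hjk', R.hba j hj hjk]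

/-- If all `2k` low-level reads meet a write on their register, there are at least `k`
AWrites: successive reads of the same register meet writes of strictly later AWrites. -/
theorem le_of_reads_overlap {N k : ℕ} (W : DWWriter N) (R : KScan k)
    (hA : ∀ j, 1 ≤ j → j ≤ k →
      ∃ i, 1 ≤ i ∧ i ≤ N ∧ W.sa i ≤ R.rae j ∧ R.ras j ≤ W.ea i)
    (hB : ∀ j, 1 ≤ j → j ≤ k →
      ∃ i, 1 ≤ i ∧ i ≤ N ∧ W.sb i ≤ R.rbe j ∧ R.rbs j ≤ W.eb i) : k ≤ N := by
  have key : ∀ j, 1 ≤ j → j ≤ k → ∃ m, j ≤ m ∧ m ≤ N ∧ W.sb m ≤ R.rbe j := by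
    intro j hj
    induction j, hj using Nat.le_induction with
    | base =>
      intro hk
      obtain ⟨m, h1, hmN, hm, -⟩ := hB 1 le_rfl hk
      exact ⟨m, h1, hmN, hm⟩
    | succ j hj ih =>
      intro hjk
      obtain ⟨m, hjm, hmN, hm⟩ := ih (by omega)
      obtain ⟨i, hi, hiN, his, hie⟩ := hA (j + 1) (by omega) hjk
      obtain ⟨n, hn, hnN, hns, hne⟩ := hB (j + 1) (by omega) hjk
      have hmi : m < i := by
        by_contra! him
        linarith [W.ea_lt_sb hi him hmN, R.hba j hj hjk]
      have hin : i ≤ n := by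
        by_contra! hni
        linarith [W.eb_lt_sa hn hni hiN, R.hab (j + 1) (by omega) hjk]
      exact ⟨n, by omega, hnN, hns⟩
  rcases Nat.eq_zero_or_pos k with rfl | hk
  · exact N.zero_le
  · obtain ⟨m, hkm, hmN, -⟩ := key k hk le_rfl
    exact hkm.trans hmN

/-- Quasi-regularity of AReadk (Lemma 1, part 1): with `N ≤ k − 1` AWrites of
pairwise distinct values, a unanimous AReadk value `v` equals `x i` for some
`L ≤ i ≤ N`, where `L` is the index of the last AWrite completed before the
AReadk begins.  In particular `v` is never contaminated and never older than
the last AWrite completed before the AReadk begins. -/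
theorem areadk_quasi_regular {N k : ℕ} (hk : 1 ≤ k) (hN : N ≤ k - 1)
    (W : DWWriter N)
    (hdist : ∀ i j, i ≤ N → j ≤ N → W.x i = W.x j → i = j)
    (R : KScan k) (hsem : SafeSem W R)
    (v : ℕ) (hret : Returns R v) :
    ∃ i, lastB W (R.ras 1) ≤ i ∧ i ≤ N ∧ v = W.x i := by
  by_contra! hne
  refine absurd (le_of_reads_overlap W R (fun j hj hjk => ?_) fun j hj hjk => ?_) (by omega)
  · by_contra! hno
    refine hne (lastA W (R.ras j))
      ((lastB_mono W (R.ras_one_le hj hjk)).trans (lastB_le_lastA W _)) (lastA_le W _) ?_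
    rw [← (hret j hj hjk).1]
    refine hsem.1 j hj hjk fun i hi hiN => ?_
    by_contra! h
    exact (hno i hi hiN h.1).not_ge h.2
  · by_contra! hno
    have hab : R.ras j ≤ R.rbs j := (R.hra j hj hjk).trans (R.hab j hj hjk).le
    refine hne (lastB W (R.rbs j))
      (lastB_mono W ((R.ras_one_le hj hjk).trans hab)) (lastB_le W _) ?_
    rw [← (hret j hj hjk).2]
    refine hsem.2 j hj hjk fun i hi hiN => ?_
    by_contra! h
    exact (hno i hi hiN h.1).not_ge h.2
end

section
/- (No new–old inversion for AReadk; Lemma 1, part 2.) In the duplicate-write/k-scan model, suppose k ≥ 1, the writer performs N ≤ k − 1 AWrite operations, and the values x₀, x₁, …, x_N are pairwise distinct. If the reader performs two AReadk operations A and A' such that every low-level read of A ends before every low-level read of A' begins, and A returns the unanimous value x_j while A' returns the unanimous value x_i, then j ≤ i; that is, a later AReadk never returns an older value than an earlier AReadk. -/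
open scoped Classical

namespace DWWriter

variable {N : ℕ} (W : DWWriter N)

theorem eb_lt_sa_s6 {i j : ℕ} (hi : 1 ≤ i) (hij : i < j) (hj : j ≤ N) : W.eb i < W.sa j := by
  induction j, hij using Nat.le_induction with
  | base => exact W.hba i hi hj
  | succ n hn ih =>
    have h₁ := ih (by omega)
    have h₂ := W.ha n (by omega) (by omega)
    have h₃ := W.hab n (by omega) (by omega)
    have h₄ := W.hb n (by omega) (by omega)
    have h₅ := W.hba n (by omega) (by omega)
    linarith

theorem ea_lt_eb {i : ℕ} (hi : 1 ≤ i) (hiN : i ≤ N) : W.ea i < W.eb i :=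
  (W.hab i hi hiN).trans_le (W.hb i hi hiN)

theorem ea_le_ea {i j : ℕ} (hi : 1 ≤ i) (hij : i ≤ j) (hj : j ≤ N) : W.ea i ≤ W.ea j := by
  rcases hij.eq_or_lt with rfl | hlt
  · exact le_rfl
  · have h₁ := W.ea_lt_eb hi (by omega)
    have h₂ := W.eb_lt_sa_s6 hi hlt hj
    have h₃ := W.ha j (by omega) hj
    linarith

end DWWriter

/-- The index returned by `lastA` and `lastB`: the largest `i ∈ {1, …, N}` satisfying `e i < t`,
or `0` if there is none. -/
theorem sup_filter_lt_spec (N : ℕ) (e : ℕ → ℝ) (t : ℝ) :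
    let m := ((Finset.range (N + 1)).filter (fun i => 1 ≤ i ∧ e i < t)).sup id
    m ≤ N ∧ (1 ≤ m → e m < t) ∧ ∀ i, 1 ≤ i → i ≤ N → e i < t → i ≤ m := by
  intro m
  refine ⟨Finset.sup_le fun i hi => ?_, fun hm => ?_, fun i hi hiN hit => ?_⟩
  · simp only [Finset.mem_filter, Finset.mem_range] at hi
    simp only [id]
    omega
  · have hne : ((Finset.range (N + 1)).filter (fun i => 1 ≤ i ∧ e i < t)).Nonempty := by
      by_contra h
      rw [Finset.not_nonempty_iff_eq_empty] at h
      simp [m, h] at hm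
    obtain ⟨i, hi, him⟩ := Finset.exists_mem_eq_sup _ hne id
    have hmi : m = i := him
    rw [hmi]
    exact (Finset.mem_filter.mp hi).2.2
  · exact Finset.le_sup (f := id)
      (Finset.mem_filter.mpr ⟨Finset.mem_range.mpr (by omega), hi, hit⟩)

theorem lastA_spec {N : ℕ} (W : DWWriter N) (t : ℝ) :
    lastA W t ≤ N ∧ (1 ≤ lastA W t → W.ea (lastA W t) < t) ∧
      ∀ i, 1 ≤ i → i ≤ N → W.ea i < t → i ≤ lastA W t :=
  sup_filter_lt_spec N W.ea t

theorem lastB_spec {N : ℕ} (W : DWWriter N) (t : ℝ) :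
    lastB W t ≤ N ∧ (1 ≤ lastB W t → W.eb (lastB W t) < t) ∧
      ∀ i, 1 ≤ i → i ≤ N → W.eb i < t → i ≤ lastB W t :=
  sup_filter_lt_spec N W.eb t

namespace KScan

variable {k : ℕ} (R : KScan k)

theorem rbe_lt_ras {p q : ℕ} (hp : 1 ≤ p) (hpq : p < q) (hq : q ≤ k) : R.rbe p < R.ras q := by
  induction q, hpq using Nat.le_induction with
  | base => exact R.hba p hp hq
  | succ n hn ih =>
    have h₁ := ih (by omega)
    have h₂ := R.hra n (by omega) (by omega)
    have h₃ := R.hab n (by omega) (by omega)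
    have h₄ := R.hrb n (by omega) (by omega)
    have h₅ := R.hba n (by omega) (by omega)
    linarith

theorem ras_lt_rbe {p : ℕ} (hp : 1 ≤ p) (hpk : p ≤ k) : R.ras p < R.rbe p :=
  ((R.hra p hp hpk).trans_lt (R.hab p hp hpk)).trans_le (R.hrb p hp hpk)

theorem ras_le_ras {p q : ℕ} (hp : 1 ≤ p) (hpq : p ≤ q) (hq : q ≤ k) : R.ras p ≤ R.ras q := by
  rcases hpq.eq_or_lt with rfl | hlt
  · exact le_rfl
  · exact ((R.ras_lt_rbe hp (by omega)).trans (R.rbe_lt_ras hp hlt hq)).le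

theorem rbe_le_rbe {p q : ℕ} (hp : 1 ≤ p) (hpq : p ≤ q) (hq : q ≤ k) : R.rbe p ≤ R.rbe q := by
  rcases hpq.eq_or_lt with rfl | hlt
  · exact le_rfl
  · exact ((R.rbe_lt_ras hp hlt hq).trans (R.ras_lt_rbe (by omega) hq)).le

end KScan

/-- If there are more reads than writes on a register, then some read meets no write, or two reads
meet the same write. -/
theorem exists_clean_or_exists_shared {N k : ℕ} (hNk : N < k) (rs re s e : ℕ → ℝ) :
    (∃ p, 1 ≤ p ∧ p ≤ k ∧ ∀ m, 1 ≤ m → m ≤ N → re p < s m ∨ e m < rs p) ∨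
      ∃ p q m, 1 ≤ p ∧ p < q ∧ q ≤ k ∧ 1 ≤ m ∧ m ≤ N ∧ s m ≤ re p ∧ rs q ≤ e m := by
  by_contra! h
  obtain ⟨hmeet, hshared⟩ := h
  choose! f hf using hmeet
  obtain ⟨p, hp, q, hq, hpq, hfpq⟩ :=
    Finset.exists_ne_map_eq_of_card_lt_of_maps_to
      (s := Finset.Icc 1 k) (t := Finset.Icc 1 N) (f := f) (by simpa using hNk)
      (fun p hp => by
        have hp' := Finset.mem_Icc.mp hp
        have := hf p hp'.1 hp'.2
        exact Finset.mem_coe.mpr (Finset.mem_Icc.mpr ⟨this.1, this.2.1⟩))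
  rw [Finset.mem_Icc] at hp hq
  obtain ⟨hp₁, hpN, hps, hpe⟩ := hf p hp.1 hp.2
  obtain ⟨hq₁, hqN, hqs, hqe⟩ := hf q hq.1 hq.2
  rcases hpq.lt_or_gt with hlt | hlt
  · exact (hshared p q (f p) hp.1 hlt hq.2 hp₁ hpN hps).not_ge (hfpq ▸ hqe)
  · exact (hshared q p (f q) hq.1 hlt hp.2 hq₁ hqN hqs).not_ge (hfpq ▸ hpe)

/-- If an AReadk returns `x j`, then the write of `x j` to `R_a` completes before it ends. -/
theorem ea_lt_of_returns {N k : ℕ} (hNk : N < k) (W : DWWriter N)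
    (hdist : ∀ i j, i ≤ N → j ≤ N → W.x i = W.x j → i = j)
    (R : KScan k) (hsem : SafeSem W R) {j : ℕ} (hj₁ : 1 ≤ j) (hj : j ≤ N)
    (hret : Returns R (W.x j)) : W.ea j < R.rbe k := by
  rcases exists_clean_or_exists_shared hNk R.rbs R.rbe W.sb W.eb with
    ⟨p, hp, hpk, hclean⟩ | ⟨p, q, m, hp, hpq, hqk, hm, hmN, hps, hqe⟩
  · obtain ⟨hle, hlt, -⟩ := lastB_spec W (R.rbs p)
    have hx := (hsem.2 p hp hpk hclean).symm.trans (hret p hp hpk).2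
    rw [hdist _ _ hle hj hx] at hlt
    have h₁ := hlt hj₁
    have h₂ := W.ea_lt_eb hj₁ hj
    have h₃ := R.hrb p hp hpk
    have h₄ := R.rbe_le_rbe hp hpk le_rfl
    linarith
  · have hrq := R.hab q (by omega) hqk
    have hpq' := R.rbe_lt_ras hp hpq hqk
    have hx := (hsem.1 q (by omega) hqk fun i hi hiN => by
      rcases le_or_gt i m with him | him
      · right
        have h₁ := W.ea_le_ea hi him hmN
        have h₂ := W.hab m hm hmN
        linarith
      · left
        have h₁ := W.eb_lt_sa_s6 hm him hiN
        linarith).symm.trans (hret q (by omega) hqk).1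
    obtain ⟨hle, hlt, -⟩ := lastA_spec W (R.ras q)
    rw [hdist _ _ hle hj hx] at hlt
    have h₁ := hlt hj₁
    have h₂ := R.ras_lt_rbe (by omega) hqk
    have h₃ := R.rbe_le_rbe (by omega) hqk le_rfl
    linarith

/-- If an AReadk returns `x i`, then the write of `x (i + 1)` to `R_a` does not complete before it
starts. -/
theorem le_ea_succ_of_returns {N k : ℕ} (hNk : N < k) (W : DWWriter N)
    (hdist : ∀ i j, i ≤ N → j ≤ N → W.x i = W.x j → i = j)
    (R : KScan k) (hsem : SafeSem W R) {i : ℕ} (hi : i < N)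
    (hret : Returns R (W.x i)) : R.ras 1 ≤ W.ea (i + 1) := by
  rcases exists_clean_or_exists_shared hNk R.ras R.rae W.sa W.ea with
    ⟨p, hp, hpk, hclean⟩ | ⟨p, q, m, hp, hpq, hqk, hm, hmN, hps, hqe⟩
  · obtain ⟨hle, -, hmax⟩ := lastA_spec W (R.ras p)
    have hx := (hsem.1 p hp hpk hclean).symm.trans (hret p hp hpk).1
    rw [hdist _ _ hle hi.le hx] at hmax
    by_contra! h
    have := hmax (i + 1) (by omega) hi (h.trans_le (R.ras_le_ras le_rfl hp hpk))
    omega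
  · have hpk : p ≤ k := by omega
    have hrp := R.hab p hp hpk
    have hpq' := R.rbe_lt_ras hp hpq hqk
    have hx := (hsem.2 p hp hpk fun l hl hlN => by
      rcases lt_or_ge l m with hlm | hlm
      · right
        have h₁ := W.eb_lt_sa_s6 hl hlm hmN
        linarith
      · left
        have h₁ := W.ea_le_ea hm hlm hlN
        have h₂ := W.hab l hl hlN
        linarith).symm.trans (hret p hp hpk).2
    obtain ⟨hle, -, hmax⟩ := lastB_spec W (R.rbs p)
    rw [hdist _ _ hle hi.le hx] at hmax
    have hmi : m ≤ i + 1 := by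
      by_contra! h
      have h₁ := W.eb_lt_sa_s6 (i := i + 1) (by omega) h hmN
      have := hmax (i + 1) (by omega) hi (by linarith)
      omega
    exact ((R.ras_le_ras le_rfl (by omega) hqk).trans hqe).trans (W.ea_le_ea hm hmi hi)

/-- No new–old inversion for AReadk (Lemma 1, part 2): with `N ≤ k − 1` AWrites
of pairwise distinct values, if AReadk `A` completes before AReadk `A'` begins,
`A` returns the unanimous value `x j` and `A'` returns the unanimous value
`x i`, then `j ≤ i`: a later AReadk never returns an older value. -/
theorem areadk_no_new_old_inversion {N k : ℕ} (hk : 1 ≤ k) (hN : N ≤ k - 1)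
    (W : DWWriter N)
    (hdist : ∀ i j, i ≤ N → j ≤ N → W.x i = W.x j → i = j)
    (A A' : KScan k) (hsemA : SafeSem W A) (hsemA' : SafeSem W A')
    (hsep : A.rbe k < A'.ras 1)
    (i j : ℕ) (hi : i ≤ N) (hj : j ≤ N)
    (hretA : Returns A (W.x j)) (hretA' : Returns A' (W.x i)) :
    j ≤ i := by
  by_contra! hij
  have h₁ := ea_lt_of_returns (by omega) W hdist A hsemA (by omega) hj hretA
  have h₂ := le_ea_succ_of_returns (by omega) W hdist A' hsemA' (by omega) hretA'
  have h₃ := W.ea_le_ea (by omega) hij hj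
  linarith
end

section
/- Each increment changes exactly one bit of the Gray code: for every natural number n, gray(n) XOR gray(n+1) = 2^t, where t is the 2-adic valuation of n+1 (the number of trailing zero bits of n+1). In particular, the binary representations of gray(n) and gray(n+1) differ in exactly one bit position. -/
/-- The binary reflected Gray code of `n`: `n XOR (n >>> 1)`. -/
def gray (n : ℕ) : ℕ := n ^^^ (n / 2)

/-- Incrementing `n` flips exactly the bits up to the lowest set bit of `n + 1`. -/
theorem Nat.xor_succ_eq_two_pow_sub_one (n : ℕ) :
    n ^^^ (n + 1) = 2 ^ (padicValNat 2 (n + 1) + 1) - 1 := by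
  induction n using Nat.strong_induction_on with
  | _ n ih =>
    have hmod : (n ^^^ (n + 1)) % 2 = 1 := by rw [Nat.xor_mod_two_eq]; omega
    have hdiv : (n ^^^ (n + 1)) / 2 = n / 2 ^^^ (n + 1) / 2 := Nat.xor_div_two
    obtain ⟨m, rfl | rfl⟩ := n.even_or_odd'
    · have hval : padicValNat 2 (2 * m + 1) = 0 :=
        padicValNat.eq_zero_of_not_dvd (by omega)
      rw [show 2 * m / 2 = m by omega, show (2 * m + 1) / 2 = m by omega, Nat.xor_self] at hdiv
      rw [hval]
      omega
    · have hval : padicValNat 2 (2 * m + 1 + 1) = padicValNat 2 (m + 1) + 1 := by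
        rw [show 2 * m + 1 + 1 = 2 * (m + 1) by ring,
          padicValNat.mul (by norm_num) (by omega), padicValNat_self, add_comm]
      rw [show (2 * m + 1) / 2 = m by omega, show (2 * m + 1 + 1) / 2 = m + 1 by omega,
        ih m (by omega)] at hdiv
      rw [hval, pow_succ]
      have := Nat.two_pow_pos (padicValNat 2 (m + 1) + 1)
      omega

/-- The Gray code is additive with respect to bitwise XOR. -/
theorem gray_xor (m n : ℕ) : gray (m ^^^ n) = gray m ^^^ gray n := by
  simp only [gray, Nat.xor_div_two]
  ac_rfl

theorem gray_two_pow_sub_one (k : ℕ) : gray (2 ^ (k + 1) - 1) = 2 ^ k := by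
  have hdiv : (2 ^ (k + 1) - 1) / 2 = 2 ^ k - 1 := by
    rw [pow_succ]
    omega
  refine Nat.eq_of_testBit_eq fun i => ?_
  rw [gray, hdiv, Nat.testBit_xor, Nat.testBit_two_pow_sub_one, Nat.testBit_two_pow_sub_one,
    Nat.testBit_two_pow]
  grind

/-- Each increment changes exactly one bit of the Gray code:
`gray n XOR gray (n+1) = 2 ^ t` where `t` is the 2-adic valuation of `n + 1`;
in particular `gray n` and `gray (n+1)` differ in exactly one bit position. -/
theorem gray_succ_xor (n : ℕ) :
    gray n ^^^ gray (n + 1) = 2 ^ padicValNat 2 (n + 1) ∧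
      ∃! t : ℕ, Nat.testBit (gray n) t ≠ Nat.testBit (gray (n + 1)) t := by
  have hxor : gray n ^^^ gray (n + 1) = 2 ^ padicValNat 2 (n + 1) := by
    rw [← gray_xor, Nat.xor_succ_eq_two_pow_sub_one, gray_two_pow_sub_one]
  have hbit (t : ℕ) : Nat.testBit (gray n) t ≠ Nat.testBit (gray (n + 1)) t ↔
      padicValNat 2 (n + 1) = t := by
    rw [← bne_iff_ne, Bool.bne_eq_xor, ← Nat.testBit_xor, hxor, Nat.testBit_two_pow,
      decide_eq_true_iff]
  exact ⟨hxor, padicValNat 2 (n + 1), (hbit _).2 rfl, fun t ht => ((hbit t).1 ht).symm⟩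
end

section
/- Dijkstra's K-state token ring is self-stabilizing to mutual exclusion: assume n ≥ 2 processes and K > 2n. Then (1) any step of an enabled process taken from a legitimate configuration yields a legitimate configuration; (2) every configuration has at least one enabled process (no deadlock); and (3) every infinite sequence of configurations c⁰, c¹, c², … in which each c^{t+1} is obtained from c^t by a step of some process enabled in c^t contains a legitimate configuration. -/
/-- In Dijkstra's `K`-state token ring, a configuration assigns a value in
`Fin K` to each of the `n` processes arranged in a ring.  Process `0` is
enabled iff its value equals that of process `n−1` (its ring predecessor
`0 - 1` in `Fin n`); process `i ≠ 0` is enabled iff its value differs from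
that of process `i − 1`. -/
def Enabled {n K : ℕ} [NeZero n] (c : Fin n → Fin K) (i : Fin n) : Prop :=
  if i = 0 then c i = c (i - 1) else c i ≠ c (i - 1)

/-- The step of an enabled process: process `0` replaces its value by
`c 0 + 1` (mod `K`); process `i ≠ 0` copies the value of process `i − 1`.
All other values are unchanged. -/
def step {n K : ℕ} [NeZero n] [NeZero K] (c : Fin n → Fin K) (i : Fin n) :
    Fin n → Fin K :=
  Function.update c i (if i = 0 then c i + 1 else c (i - 1))

/-- A configuration is legitimate iff exactly one process is enabled in it. -/
def Legitimate {n K : ℕ} [NeZero n] (c : Fin n → Fin K) : Prop :=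
  ∃! i : Fin n, Enabled c i

namespace TokenRing

open Filter

theorem fin_val_sub_one {n : ℕ} [NeZero n] {i : Fin n} (hi : i ≠ 0) :
    (i - 1).val = i.val - 1 := by
  obtain ⟨m, rfl⟩ : ∃ m, n = m + 1 := Nat.exists_eq_succ_of_ne_zero (NeZero.ne n)
  exact Fin.val_sub_one_of_ne_zero hi

theorem fin_le_zero_sub_one {n : ℕ} [NeZero n] (i : Fin n) : i ≤ 0 - 1 := by
  obtain ⟨m, rfl⟩ : ∃ m, n = m + 1 := Nat.exists_eq_succ_of_ne_zero (NeZero.ne n)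
  have h : (0 : Fin (m + 1)) - 1 = Fin.last m := by
    rw [sub_eq_iff_eq_add]
    exact (Fin.last_add_one m).symm
  rw [h]
  exact Fin.le_last i

theorem fin_sub_one_ne {n : ℕ} [NeZero n] (hn : 2 ≤ n) (i : Fin n) : i - 1 ≠ i := by
  obtain ⟨m, rfl⟩ : ∃ m, n = m + 2 := ⟨n - 2, by omega⟩
  simp

/-- Induction along the ring, from process `0` onwards. -/
theorem ring_induction {n : ℕ} [NeZero n] {P : Fin n → Prop} (zero : P 0)
    (succ : ∀ i, i ≠ 0 → P (i - 1) → P i) (i : Fin n) : P i := by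
  induction h : i.val generalizing i with
  | zero => rwa [show i = 0 from Fin.ext h]
  | succ k ih =>
    have hi : i ≠ 0 := by
      rintro rfl
      simp at h
    exact succ i hi (ih _ (by rw [fin_val_sub_one hi, h]; rfl))

/-- A predicate inherited by ring predecessors that holds at the last process holds everywhere. -/
theorem forall_of_last {n : ℕ} [NeZero n] {P : Fin n → Prop} (last : P (0 - 1))
    (pred : ∀ i, i ≠ 0 → P i → P (i - 1)) (i : Fin n) : P i := by
  have key : ∀ k : Fin n, P k → ∀ j ≤ k, P j := by
    refine ring_induction ?_ ?_
    · intro h j hj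
      rwa [show j = 0 from Fin.ext (Nat.le_zero.mp hj)]
    · intro k hk ih h j hj
      rcases eq_or_lt_of_le hj with rfl | hlt
      · exact h
      · refine ih (pred k hk h) j ?_
        rw [Fin.le_def, fin_val_sub_one hk]
        have := Fin.lt_def.mp hlt
        omega
  exact key _ last i (fin_le_zero_sub_one i)

variable {n K : ℕ} [NeZero n]

theorem enabled_zero {c : Fin n → Fin K} : Enabled c 0 ↔ c 0 = c (0 - 1) := by
  simp [Enabled]

theorem enabled_of_ne_zero {c : Fin n → Fin K} {i : Fin n} (hi : i ≠ 0) :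
    Enabled c i ↔ c i ≠ c (i - 1) := by
  simp [Enabled, hi]

theorem exists_enabled (c : Fin n → Fin K) : ∃ i, Enabled c i := by
  by_contra! h
  have hall : ∀ i, c i = c 0 :=
    ring_induction rfl fun i hi ih =>
      (not_not.mp fun hne => h i ((enabled_of_ne_zero hi).mpr hne)).trans ih
  exact h 0 (enabled_zero.mpr (hall _).symm)

theorem legitimate_of_const {c : Fin n → Fin K} {v : Fin K} (h : ∀ i, c i = v) :
    Legitimate c := by
  refine ⟨0, enabled_zero.mpr ((h _).trans (h _).symm), fun i hi => ?_⟩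
  by_contra h0
  exact (enabled_of_ne_zero h0).mp hi ((h _).trans (h _).symm)

variable [NeZero K]

theorem step_of_ne (c : Fin n → Fin K) {i j : Fin n} (h : j ≠ i) : step c i j = c j := by
  simp [step, h]

theorem step_zero (c : Fin n → Fin K) : step c 0 0 = c 0 + 1 := by
  simp [step]

theorem step_self (c : Fin n → Fin K) {i : Fin n} (hi : i ≠ 0) : step c i i = c (i - 1) := by
  simp [step, hi]

theorem not_enabled_step_self (hn : 2 ≤ n) (hK : 2 ≤ K) {c : Fin n → Fin K} {i : Fin n}
    (hi : Enabled c i) : ¬ Enabled (step c i) i := by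
  by_cases h0 : i = 0
  · subst h0
    rw [enabled_zero] at hi ⊢
    rw [step_zero, step_of_ne c (fin_sub_one_ne hn 0), ← hi]
    obtain ⟨m, rfl⟩ : ∃ m, K = m + 2 := ⟨K - 2, by omega⟩
    simp
  · rw [enabled_of_ne_zero h0, not_not, step_self c h0, step_of_ne c (fin_sub_one_ne hn i)]

theorem enabled_step_iff {c : Fin n → Fin K} {i j : Fin n} (hj : j ≠ i) (hj' : j - 1 ≠ i) :
    Enabled (step c i) j ↔ Enabled c j := by
  simp only [Enabled, step_of_ne c hj, step_of_ne c hj']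

theorem legitimate_step (hn : 2 ≤ n) (hK : 2 ≤ K) {c : Fin n → Fin K} {i : Fin n}
    (hc : Legitimate c) (hi : Enabled c i) : Legitimate (step c i) := by
  have key : ∀ j, Enabled (step c i) j → j = i + 1 := by
    intro j hj
    by_contra hne
    have hji : j ≠ i := by
      rintro rfl
      exact not_enabled_step_self hn hK hi hj
    have hji' : j - 1 ≠ i := fun h => hne (sub_eq_iff_eq_add.mp h)
    exact hji (hc.unique ((enabled_step_iff hji hji').mp hj) hi)
  obtain ⟨j, hj⟩ := exists_enabled (step c i)
  exact ⟨j, hj, fun k hk => (key k hk).trans (key j hj).symm⟩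

/-- An execution of the ring with schedule `s`. -/
def Execution (c : ℕ → Fin n → Fin K) (s : ℕ → Fin n) : Prop :=
  ∀ t, Enabled (c t) (s t) ∧ c (t + 1) = step (c t) (s t)

section Execution

variable {c : ℕ → Fin n → Fin K} {s : ℕ → Fin n}

theorem Execution.eq_of_ne (h : Execution c s) {t : ℕ} {j : Fin n} (hj : s t ≠ j) :
    c (t + 1) j = c t j := by
  rw [(h t).2, step_of_ne _ hj.symm]

theorem Execution.succ_zero (h : Execution c s) {t : ℕ} (ht : s t = 0) :
    c (t + 1) 0 = c t 0 + 1 := by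
  rw [(h t).2, ht, step_zero]

theorem Execution.succ_self (h : Execution c s) {t : ℕ} {j : Fin n} (hj : j ≠ 0) (ht : s t = j) :
    c (t + 1) j = c t (j - 1) := by
  rw [(h t).2, ht, step_self _ hj]

/-- If process `0` eventually stops moving, then every process eventually stops changing. -/
theorem Execution.eventually_const (h : Execution c s) {T : ℕ} (hT : ∀ t ≥ T, s t ≠ 0)
    (j : Fin n) : ∃ w, ∀ᶠ t in atTop, c t j = w := by
  refine ring_induction (P := fun j => ∃ w, ∀ᶠ t in atTop, c t j = w) ?_ ?_ j
  · refine ⟨c T 0, eventually_atTop.mpr ⟨T, fun t ht => ?_⟩⟩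
    induction t, ht using Nat.le_induction with
    | base => rfl
    | succ t ht ih => rw [h.eq_of_ne (hT t ht), ih]
  · rintro i hi ⟨w, hw⟩
    obtain ⟨T₁, hT₁⟩ := eventually_atTop.mp hw
    by_cases hmove : ∃ t₁ ≥ T₁, s t₁ = i
    · obtain ⟨t₁, ht₁, hs⟩ := hmove
      refine ⟨w, eventually_atTop.mpr ⟨t₁ + 1, fun t ht => ?_⟩⟩
      induction t, ht using Nat.le_induction with
      | base => rw [h.succ_self hi hs, hT₁ t₁ ht₁]
      | succ t ht ih =>
        by_cases hst : s t = i
        · rw [h.succ_self hi hst, hT₁ t (by omega)]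
        · rw [h.eq_of_ne hst, ih]
    · push Not at hmove
      refine ⟨c T₁ i, eventually_atTop.mpr ⟨T₁, fun t ht => ?_⟩⟩
      induction t, ht using Nat.le_induction with
      | base => rfl
      | succ t ht ih => rw [h.eq_of_ne (hmove t ht), ih]

/-- Process `0` moves infinitely often. -/
theorem Execution.exists_zero_move (h : Execution c s) (T : ℕ) : ∃ t ≥ T, s t = 0 := by
  by_contra! hT
  choose w hw using h.eventually_const hT
  obtain ⟨T₁, hT₁⟩ := eventually_atTop.mp (eventually_all.mpr hw)
  set t := max T T₁
  have h0 : s t ≠ 0 := hT t (le_max_left _ _)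
  have hle : T₁ ≤ t := le_max_right _ _
  refine (enabled_of_ne_zero h0).mp (h t).1 ?_
  rw [← h.succ_self h0 rfl, hT₁ t hle, hT₁ (t + 1) (by omega)]

theorem Execution.exists_eq_add (h : Execution c s) (k : ℕ) :
    ∃ t, (c t 0).val = ((c 0 0).val + k) % K := by
  induction k with
  | zero => exact ⟨0, by rw [add_zero, Nat.mod_eq_of_lt (c 0 0).isLt]⟩
  | succ k ih =>
    obtain ⟨t, ht⟩ := ih
    have hex := h.exists_zero_move t
    classical
    obtain ⟨hle, hs⟩ := Nat.find_spec hex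
    have hmin : ∀ r, t ≤ r → r ≤ Nat.find hex → c r 0 = c t 0 := by
      intro r hr
      induction r, hr using Nat.le_induction with
      | base => exact fun _ => rfl
      | succ r hr ih =>
        intro hr'
        rw [h.eq_of_ne fun h0 => Nat.find_min hex (Nat.lt_of_succ_le hr') ⟨hr, h0⟩,
          ih (by omega)]
    refine ⟨Nat.find hex + 1, ?_⟩
    rw [h.succ_zero hs, hmin _ hle le_rfl, Fin.val_add, ht, Fin.val_one',
      ← Nat.add_mod, add_assoc]

/-- Process `0` takes every value. -/
theorem Execution.exists_zero_eq (h : Execution c s) (v : Fin K) : ∃ t, c t 0 = v := by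
  obtain ⟨t, ht⟩ := h.exists_eq_add (v.val + (K - (c 0 0).val))
  refine ⟨t, Fin.ext ?_⟩
  have := (c 0 0).isLt
  rw [ht, show (c 0 0).val + (v.val + (K - (c 0 0).val)) = v.val + K by omega,
    Nat.add_mod_right, Nat.mod_eq_of_lt v.isLt]

/-- A value that is absent initially is absent until process `0` takes it, and then process `0` is
its only holder. -/
theorem Execution.exists_unique_holder (h : Execution c s) {v : Fin K} (hv : ∀ j, c 0 j ≠ v) :
    ∃ t, c t 0 = v ∧ ∀ j ≠ 0, c t j ≠ v := by
  classical
  have hex := h.exists_zero_eq v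
  have key : ∀ t ≤ Nat.find hex, ∀ j ≠ 0, c t j ≠ v := by
    intro t
    induction t with
    | zero => exact fun _ j _ => hv j
    | succ t ih =>
      intro ht j hj
      by_cases hs : s t = j
      · rw [h.succ_self hj hs]
        by_cases hj' : j - 1 = 0
        · rw [hj']
          exact Nat.find_min hex ht
        · exact ih (by omega) _ hj'
      · rw [h.eq_of_ne hs]
        exact ih (by omega) j hj
  exact ⟨_, Nat.find_spec hex, key _ le_rfl⟩

theorem Execution.exists_legitimate (h : Execution c s) (hn : 2 ≤ n) (hK : n < K) :
    ∃ t, Legitimate (c t) := by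
  by_contra! hleg
  obtain ⟨v, hv⟩ : ∃ v, ∀ j, c 0 j ≠ v := by
    by_contra! hsurj
    have := Fintype.card_le_of_surjective (c 0) hsurj
    simp only [Fintype.card_fin] at this
    omega
  obtain ⟨T, hT0, hT⟩ := h.exists_unique_holder hv
  have not_last : ∀ t, (∀ j ≠ 0, c t j = v → c t (j - 1) = v) → c t (0 - 1) ≠ v :=
    fun t hp hl => hleg t (legitimate_of_const (forall_of_last hl hp))
  have move_ne : ∀ t, c t 0 = v → (∀ j ≠ 0, c t j = v → c t (j - 1) = v) → s t ≠ 0 := by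
    intro t h0 hp hs
    have he := (h t).1
    rw [hs, enabled_zero] at he
    exact not_last t hp (he.symm.trans h0)
  have inv : ∀ t ≥ T, c t 0 = v ∧ ∀ j ≠ 0, c t j = v → c t (j - 1) = v := by
    intro t ht
    induction t, ht using Nat.le_induction with
    | base => exact ⟨hT0, fun j hj hjv => absurd hjv (hT j hj)⟩
    | succ t ht ih =>
      obtain ⟨h0, hp⟩ := ih
      have hs := move_ne t h0 hp
      refine ⟨(h.eq_of_ne hs).trans h0, fun j hj hjv => ?_⟩
      by_cases hsj : s t = j
      · rw [h.succ_self hj hsj] at hjv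
        rwa [h.eq_of_ne fun heq => fin_sub_one_ne hn j (heq.symm.trans hsj)]
      · rw [h.eq_of_ne hsj] at hjv
        by_cases hsj' : s t = j - 1
        · have hne : j - 1 ≠ 0 := hsj' ▸ hs
          rw [h.succ_self hne hsj']
          exact hp _ hne (hp j hj hjv)
        · rw [h.eq_of_ne hsj']
          exact hp j hj hjv
  obtain ⟨t, ht, hs⟩ := h.exists_zero_move T
  exact move_ne t (inv t ht).1 (inv t ht).2 hs

end Execution

end TokenRing

/-- Dijkstra's `K`-state token ring is self-stabilizing to mutual exclusion:
for `n ≥ 2` processes and `K > 2n`, (1) legitimacy is closed under steps of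
enabled processes, (2) every configuration has an enabled process (no
deadlock), and (3) every infinite execution, in which each configuration is
obtained from the previous one by a step of an enabled process, contains a
legitimate configuration. -/
theorem dijkstra_self_stabilizing (n K : ℕ) [NeZero n] [NeZero K]
    (hn : 2 ≤ n) (hK : 2 * n < K) :
    (∀ (c : Fin n → Fin K) (i : Fin n),
        Legitimate c → Enabled c i → Legitimate (step c i)) ∧
    (∀ c : Fin n → Fin K, ∃ i : Fin n, Enabled c i) ∧
    (∀ c : ℕ → Fin n → Fin K,
        (∀ t : ℕ, ∃ i : Fin n, Enabled (c t) i ∧ c (t + 1) = step (c t) i) →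
        ∃ t : ℕ, Legitimate (c t)) := by
  refine ⟨fun c i => TokenRing.legitimate_step hn (by omega), TokenRing.exists_enabled,
    fun c hc => ?_⟩
  choose s hs using hc
  exact TokenRing.Execution.exists_legitimate (s := s) hs hn (by omega)
end
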